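/- Assume q_0 is supported in the Euclidean ball {y ∈ ℝ^d : ‖y‖₂ ≤ √d}. Then there is a universal constant C > 0 such that for every t > 0, E_{X ~ q_t}[ ‖∇_x² log q_t(X) · ∇_x log q_t(X)‖₂² ] ≤ C d³ σ_t^{−6}, where ∇_x² log q_t(X) · ∇_x log q_t(X) denotes the Hessian matrix of log q_t at X applied to the gradient of log q_t at X. -/

import Mathlib

open MeasureTheory ProbabilityTheory Real

noncomputable section

abbrev Vec (d : ℕ) := EuclideanSpace ℝ (Fin d)

def stdGaussian (d : ℕ) : Measure (Vec d) :=
  Measure.map (⇑(EuclideanSpace.equiv (Fin d) ℝ).symm)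
    (Measure.pi fun _ : Fin d => gaussianReal 0 1)

/-- The law `q_u` of `e^{-u} θ + √(1 - e^{-2u}) g`, with `θ ~ q0` and `g ~ N(0, I_d)`
independent. -/
def forwardLaw {d : ℕ} (q0 : Measure (Vec d)) (u : ℝ) : Measure (Vec d) :=
  Measure.map (fun p : Vec d × Vec d =>
      Real.exp (-u) • p.1 + Real.sqrt (1 - Real.exp (-2*u)) • p.2)
    (q0.prod (stdGaussian d))

/-- Gaussian weight `exp(-‖x - λ_t θ‖² / (2σ_t²))`. -/
def weight {d : ℕ} (t : ℝ) (x θ : Vec d) : ℝ :=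
  Real.exp (-‖x - Real.exp (-t) • θ‖^2 / (2 * (1 - Real.exp (-2*t))))

/-- The conditional law `μ_{t,x}` of `θ` given `λ_t θ + σ_t g = x`:
`dμ_{t,x}(θ) = Z_{t,x}⁻¹ exp(-‖x - λ_t θ‖²/(2σ_t²)) dq0(θ)`. -/
def condMeasure {d : ℕ} (q0 : Measure (Vec d)) (t : ℝ) (x : Vec d) : Measure (Vec d) :=
  (∫⁻ θ, ENNReal.ofReal (weight t x θ) ∂q0)⁻¹ •
    q0.withDensity fun θ => ENNReal.ofReal (weight t x θ)

/-- The conditional mean `m(t, x) = E_{t,x}[θ]`. -/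
def condMean {d : ℕ} (q0 : Measure (Vec d)) (t : ℝ) (x : Vec d) : Vec d :=
  ∫ θ, θ ∂(condMeasure q0 t x)

/-- Partial derivative in the `i`-th coordinate direction. -/
def pd {d : ℕ} (i : Fin d) (f : Vec d → ℝ) (x : Vec d) : ℝ :=
  fderiv ℝ f x (EuclideanSpace.single i 1)

theorem pi_gaussianReal_eq_withDensity {ι : Type*} [Fintype ι] (a : ι → ℝ) {v : NNReal}
    (hv : v ≠ 0) :
    Measure.pi (fun i => gaussianReal (a i) v) =
      volume.withDensity fun x : ι → ℝ => ENNReal.ofReal (∏ i, gaussianPDFReal (a i) v (x i)) := by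
  refine Measure.pi_eq fun s hs => ?_
  rw [withDensity_apply _ (MeasurableSet.univ_pi hs), volume_pi, Measure.restrict_pi_pi,
    ← ofReal_integral_eq_lintegral_ofReal
      (Integrable.fintype_prod fun i => (integrable_gaussianPDFReal (a i) v).restrict)
      (ae_of_all _ fun x => Finset.prod_nonneg fun i _ => gaussianPDFReal_nonneg _ _ _),
    integral_fintype_prod_eq_prod (fun i => gaussianPDFReal (a i) v),
    ENNReal.ofReal_prod_of_nonneg fun i _ =>
      integral_nonneg fun x => gaussianPDFReal_nonneg _ _ _]
  exact Finset.prod_congr rfl fun i _ => (gaussianReal_apply_eq_integral _ hv _).symm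

theorem map_stdGaussian_eq_withDensity {d : ℕ} (a : Vec d) {σ : ℝ} (hσ : 0 < σ) :
    (stdGaussian d).map (fun g => a + σ • g) = volume.withDensity fun x =>
      ENNReal.ofReal ((√(2 * π * σ ^ 2))⁻¹ ^ d * rexp (-‖x - a‖ ^ 2 / (2 * σ ^ 2))) := by
  let v : NNReal := ⟨σ ^ 2, sq_nonneg σ⟩
  have hv : v ≠ 0 := fun h => (pow_pos hσ 2).ne' (congrArg NNReal.toReal h)
  have hcoord (i : Fin d) :
      gaussianReal (a i) v = (gaussianReal 0 1).map (fun y => a i + σ * y) := by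
    rw [show (fun y => a i + σ * y) = (fun y => a i + y) ∘ (fun y => σ * y) from rfl,
      ← Measure.map_map (by fun_prop) (by fun_prop), gaussianReal_map_const_mul,
      gaussianReal_map_const_add]
    congr 1 <;> simp [v]
    rfl
  have hpi := pi_gaussianReal_eq_withDensity (fun i => a i) hv
  simp_rw [hcoord] at hpi
  rw [← Measure.pi_map_pi (fun i => by fun_prop)] at hpi
  have hmp := PiLp.volume_preserving_toLp (Fin d)
  have hmeas : Measurable (@WithLp.toLp 2 (Fin d → ℝ)) := hmp.measurable
  ext s hs
  have hpi_s := congrArg (fun μ => μ (WithLp.toLp 2 ⁻¹' s)) hpi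
  rw [Measure.map_apply (by fun_prop) (hmeas hs), withDensity_apply _ (hmeas hs)] at hpi_s
  rw [_root_.stdGaussian, Measure.map_map (by fun_prop) (by fun_prop),
    Measure.map_apply (by fun_prop) hs, withDensity_apply _ hs,
    ← hmp.setLIntegral_comp_preimage hs (by fun_prop)]
  refine Eq.trans ?_ (hpi_s.trans ?_)
  · congr 1
  · refine lintegral_congr fun x => ?_
    congr 1
    simp only [gaussianPDFReal, Finset.prod_mul_distrib, Finset.prod_const, Finset.card_univ,
      Fintype.card_fin, ← Real.exp_sum, EuclideanSpace.norm_sq_eq, Real.norm_eq_abs, sq_abs,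
      PiLp.sub_apply, ← Finset.sum_div, Finset.sum_neg_distrib]
    rfl

theorem one_sub_exp_neg_two_mul_pos {t : ℝ} (ht : 0 < t) : 0 < 1 - rexp (-2 * t) :=
  sub_pos.2 (Real.exp_lt_one_iff.2 (by linarith))

theorem continuous_weight {d : ℕ} (t : ℝ) :
    Continuous fun p : Vec d × Vec d => weight t p.1 p.2 := by
  unfold weight
  fun_prop

theorem weight_pos {d : ℕ} (t : ℝ) (x θ : Vec d) : 0 < weight t x θ := Real.exp_pos _

theorem weight_le_one {d : ℕ} {t : ℝ} (ht : 0 < t) (x θ : Vec d) : weight t x θ ≤ 1 := by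
  have := one_sub_exp_neg_two_mul_pos ht
  refine Real.exp_le_one_iff.2 (div_nonpos_of_nonpos_of_nonneg ?_ (by positivity))
  exact neg_nonpos.2 (sq_nonneg _)

theorem integrable_weight {d : ℕ} (q0 : Measure (Vec d)) [IsProbabilityMeasure q0] {t : ℝ}
    (ht : 0 < t) (x : Vec d) : Integrable (weight t x) q0 := by
  refine Integrable.of_bound (C := 1)
    ((continuous_weight t).comp (Continuous.prodMk_right x)).aestronglyMeasurable
    (ae_of_all _ fun θ => ?_)
  rw [Real.norm_of_nonneg (weight_pos t x θ).le]
  exact weight_le_one ht x θ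

/-- The normalizing constant `(2πσ_t²)^{-d/2}` of the Gaussian kernel. -/
def gaussianConst (d : ℕ) (t : ℝ) : ℝ := (√(2 * π * (1 - rexp (-2 * t))))⁻¹ ^ d

theorem gaussianConst_pos (d : ℕ) {t : ℝ} (ht : 0 < t) : 0 < gaussianConst d t := by
  have := one_sub_exp_neg_two_mul_pos ht
  unfold gaussianConst
  positivity

instance (d : ℕ) : IsProbabilityMeasure (_root_.stdGaussian d) :=
  Measure.isProbabilityMeasure_map (by fun_prop)

theorem lintegral_stdGaussian_affine {d : ℕ} {t : ℝ} (ht : 0 < t) (θ : Vec d)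
    {f : Vec d → ENNReal} (hf : Measurable f) :
    ∫⁻ g, f (rexp (-t) • θ + √(1 - rexp (-2 * t)) • g) ∂(_root_.stdGaussian d) =
      ∫⁻ x, ENNReal.ofReal (gaussianConst d t * weight t x θ) * f x := by
  have hs := one_sub_exp_neg_two_mul_pos ht
  have hmap := map_stdGaussian_eq_withDensity (rexp (-t) • θ) (Real.sqrt_pos.2 hs)
  rw [← lintegral_map (f := f) hf (by fun_prop), hmap,
    lintegral_withDensity_eq_lintegral_mul _ (by fun_prop) hf]
  simp only [Real.sq_sqrt hs.le, Pi.mul_apply]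
  rfl

theorem lintegral_forwardLaw {d : ℕ} (q0 : Measure (Vec d)) {t : ℝ} {f : Vec d → ENNReal}
    (hf : Measurable f) :
    ∫⁻ x, f x ∂(forwardLaw q0 t) =
      ∫⁻ θ, ∫⁻ g, f (rexp (-t) • θ + √(1 - rexp (-2 * t)) • g) ∂(_root_.stdGaussian d) ∂q0 := by
  rw [forwardLaw, lintegral_map hf (by fun_prop), lintegral_prod _ (by fun_prop)]

theorem forwardLaw_eq_withDensity {d : ℕ} (q0 : Measure (Vec d)) [IsProbabilityMeasure q0]
    {t : ℝ} (ht : 0 < t) :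
    forwardLaw q0 t = volume.withDensity fun x =>
      ENNReal.ofReal (gaussianConst d t * ∫ θ, weight t x θ ∂q0) := by
  have hc := gaussianConst_pos d ht
  have hW := (continuous_weight (d := d) t).measurable
  ext s hs
  rw [← lintegral_indicator_one hs, lintegral_forwardLaw q0 (measurable_one.indicator hs)]
  simp_rw [lintegral_stdGaussian_affine ht _ (measurable_one.indicator hs)]
  rw [lintegral_lintegral_swap, withDensity_apply _ hs, ← lintegral_indicator hs]
  · refine lintegral_congr fun x => ?_
    by_cases hx : x ∈ s
    · simp only [Set.indicator_of_mem hx, Pi.one_apply, mul_one]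
      rw [← integral_const_mul, ofReal_integral_eq_lintegral_ofReal
        ((integrable_weight q0 ht x).const_mul _)
        (ae_of_all _ fun θ => (mul_pos hc (weight_pos t x θ)).le)]
    · simp [Set.indicator_of_notMem hx]
  · refine Measurable.aemeasurable ?_
    refine Measurable.mul ?_ ((measurable_one.indicator hs).comp measurable_snd)
    exact ((hW.comp measurable_swap).const_mul _).ennreal_ofReal

theorem continuous_integral_weight {d : ℕ} (q0 : Measure (Vec d)) [IsProbabilityMeasure q0]
    {t : ℝ} (ht : 0 < t) : Continuous fun x => ∫ θ, weight t x θ ∂q0 := by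
  refine continuous_of_dominated (bound := fun _ => 1)
    (fun x => (integrable_weight q0 ht x).aestronglyMeasurable) (fun x => ae_of_all _ fun θ => ?_)
    (integrable_const _) (ae_of_all _ fun θ => ?_)
  · rw [Real.norm_of_nonneg (weight_pos t x θ).le]
    exact weight_le_one ht x θ
  · unfold weight
    fun_prop

theorem eq_integral_weight_of_forwardLaw_eq {d : ℕ} (q0 : Measure (Vec d))
    [IsProbabilityMeasure q0] {t : ℝ} (ht : 0 < t) {ρ : Vec d → ℝ}
    (hρ : forwardLaw q0 t = volume.withDensity fun x => ENNReal.ofReal (ρ x))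
    (hpos : ∀ x, 0 < ρ x) (hcont : Continuous ρ) (x : Vec d) :
    ρ x = gaussianConst d t * ∫ θ, weight t x θ ∂q0 := by
  have hcont' : Continuous fun y => gaussianConst d t * ∫ θ, weight t y θ ∂q0 :=
    (continuous_integral_weight q0 ht).const_mul (gaussianConst d t)
  have hae : (fun y => ENNReal.ofReal (ρ y)) =ᵐ[volume]
      fun y => ENNReal.ofReal (gaussianConst d t * ∫ θ, weight t y θ ∂q0) :=
    (withDensity_eq_iff_of_sigmaFinite hcont.measurable.ennreal_ofReal.aemeasurable
      hcont'.measurable.ennreal_ofReal.aemeasurable).1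
      (hρ.symm.trans (forwardLaw_eq_withDensity q0 ht))
  have hfun := (Continuous.ae_eq_iff_eq volume (ENNReal.continuous_ofReal.comp hcont)
    (ENNReal.continuous_ofReal.comp hcont')).1 hae
  refine (ENNReal.ofReal_eq_ofReal_iff (hpos x).le ?_).1 (congrFun hfun x)
  exact mul_nonneg (gaussianConst_pos d ht).le (integral_nonneg fun θ => (weight_pos t x θ).le)

theorem sq_add_add_le_of_sq_le {A r : ℝ} (hA : 0 ≤ A) (h : r ^ 2 ≤ A) :
    (A * r + r + A * r) ^ 2 ≤ 3 + 9 * A ^ 3 :=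
  calc (A * r + r + A * r) ^ 2 = (2 * A + 1) ^ 2 * r ^ 2 := by ring
    _ ≤ (2 * A + 1) ^ 2 * A := by gcongr
    _ ≤ 3 + 9 * A ^ 3 := by
      linarith [mul_nonneg hA (sq_nonneg (A - 1)), sq_nonneg A,
        mul_nonneg (add_nonneg hA zero_le_one) (sq_nonneg (A - 1))]

/-- Power-mean inequality for a bounded nonnegative function on a probability space. -/
theorem pow_integral_le_integral_pow {Ω : Type*} [MeasurableSpace Ω] {μ : Measure Ω}
    [IsProbabilityMeasure μ] {f : Ω → ℝ} (hf : AEStronglyMeasurable f μ) (hf0 : ∀ ω, 0 ≤ f ω)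
    {R : ℝ} (hR : ∀ᵐ ω ∂μ, f ω ≤ R) (n : ℕ) : (∫ ω, f ω ∂μ) ^ n ≤ ∫ ω, f ω ^ n ∂μ := by
  have hint (k : ℕ) : Integrable (fun ω => f ω ^ k) μ := by
    refine Integrable.of_bound (C := R ^ k) (hf.pow k) (hR.mono fun ω hω => ?_)
    rw [Real.norm_of_nonneg (pow_nonneg (hf0 ω) k)]
    exact pow_le_pow_left₀ (hf0 ω) hω k
  exact (convexOn_pow n).map_integral_le (continuous_pow n).continuousOn isClosed_Ici
    (ae_of_all _ hf0) (by simpa using hint 1) (hint n)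

theorem sum_sq_centered_second_moment_le {d : ℕ} {Ω : Type*} [MeasurableSpace Ω] {μ : Measure Ω}
    [IsProbabilityMeasure μ] {U : Ω → Vec d} (hU : AEStronglyMeasurable U μ) {R : ℝ}
    (hR : ∀ᵐ ω ∂μ, ‖U ω‖ ≤ R) :
    ∑ i, (∑ j, ((∫ ω, U ω i * U ω j ∂μ) - (if i = j then 1 else 0)
        - (∫ ω, U ω i ∂μ) * ∫ ω, U ω j ∂μ) * ∫ ω, U ω j ∂μ) ^ 2
      ≤ 3 + 9 * ∫ ω, ‖U ω‖ ^ 6 ∂μ := by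
  have hint : Integrable U μ := Integrable.of_bound hU R hR
  set m : Vec d := ∫ ω, U ω ∂μ
  have hmi (i : Fin d) : ∫ ω, U ω i ∂μ = m i :=
    (EuclideanSpace.proj (𝕜 := ℝ) i).integral_comp_comm hint
  have hinner_int : Integrable (fun ω => inner ℝ m (U ω) • U ω) μ := by
    refine Integrable.of_bound (C := ‖m‖ * R * R)
      ((hU.const_inner (𝕜 := ℝ) (c := m)).smul hU) (hR.mono fun ω hω => ?_)
    rw [norm_smul]
    have h0 : 0 ≤ R := (norm_nonneg (U ω)).trans hω
    calc ‖inner ℝ m (U ω)‖ * ‖U ω‖ ≤ (‖m‖ * ‖U ω‖) * ‖U ω‖ := by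
          gcongr; exact norm_inner_le_norm _ _
      _ ≤ ‖m‖ * R * R := by gcongr
  have hUi (i : Fin d) : AEStronglyMeasurable (fun ω => U ω i) μ :=
    (EuclideanSpace.proj (𝕜 := ℝ) i).continuous.comp_aestronglyMeasurable hU
  have hij (i j : Fin d) : Integrable (fun ω => U ω i * U ω j) μ := by
    refine Integrable.of_bound (C := R * R) ((hUi i).mul (hUi j)) (hR.mono fun ω hω => ?_)
    rw [norm_mul]
    have h1 := (PiLp.norm_apply_le (U ω) i).trans hω
    have h2 := (PiLp.norm_apply_le (U ω) j).trans hω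
    exact mul_le_mul h1 h2 (norm_nonneg _) ((norm_nonneg _).trans h1)
  set v : Vec d := ∫ ω, inner ℝ m (U ω) • U ω ∂μ
  have hvi (i : Fin d) : ∑ j, (∫ ω, U ω i * U ω j ∂μ) * m j = v i := by
    have h1 := (EuclideanSpace.proj (𝕜 := ℝ) i).integral_comp_comm hinner_int
    refine Eq.trans ?_ h1
    simp_rw [← integral_mul_const]
    rw [← integral_finsetSum _ fun j _ => (hij i j).mul_const _]
    refine integral_congr_ae (ae_of_all _ fun ω => ?_)
    simp only [PiLp.inner_apply, PiLp.proj_apply, PiLp.smul_apply, smul_eq_mul, Finset.sum_mul,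
      RCLike.inner_apply, conj_trivial]
    exact Finset.sum_congr rfl fun j _ => by ring
  have hsum : ∑ i, (∑ j, ((∫ ω, U ω i * U ω j ∂μ) - (if i = j then 1 else 0)
        - (∫ ω, U ω i ∂μ) * ∫ ω, U ω j ∂μ) * ∫ ω, U ω j ∂μ) ^ 2
      = ‖v - m - ‖m‖ ^ 2 • m‖ ^ 2 := by
    rw [EuclideanSpace.norm_sq_eq (v - m - ‖m‖ ^ 2 • m)]
    refine Finset.sum_congr rfl fun i _ => ?_
    simp only [Real.norm_eq_abs, sq_abs, PiLp.sub_apply, PiLp.smul_apply, smul_eq_mul, hmi,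
      sub_mul, Finset.sum_sub_distrib, hvi, EuclideanSpace.norm_sq_eq m, Finset.sum_mul, ite_mul,
      one_mul, zero_mul, Finset.sum_ite_eq, Finset.mem_univ, if_true]
    congr 2
    exact Finset.sum_congr rfl fun j _ => by ring
  set A : ℝ := ∫ ω, ‖U ω‖ ^ 2 ∂μ with hA
  have hA0 : 0 ≤ A := integral_nonneg fun ω => sq_nonneg _
  have hmA : ‖m‖ ^ 2 ≤ A :=
    (pow_le_pow_left₀ (norm_nonneg _) (norm_integral_le_integral_norm _) 2).trans
      (pow_integral_le_integral_pow hU.norm (fun ω => norm_nonneg _) hR 2)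
  have hvA : ‖v‖ ≤ A * ‖m‖ := by
    rw [hA, ← integral_mul_const]
    refine norm_integral_le_of_norm_le ?_ (ae_of_all _ fun ω => ?_)
    · refine Integrable.mul_const (Integrable.of_bound (C := R ^ 2) (hU.norm.pow 2)
        (hR.mono fun ω hω => ?_)) _
      rw [Pi.pow_apply, norm_pow, norm_norm]
      exact pow_le_pow_left₀ (norm_nonneg _) hω 2
    · rw [norm_smul]
      calc ‖inner ℝ m (U ω)‖ * ‖U ω‖ ≤ (‖m‖ * ‖U ω‖) * ‖U ω‖ := by
            gcongr; exact norm_inner_le_norm _ _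
        _ = ‖U ω‖ ^ 2 * ‖m‖ := by ring
  have hA3 : A ^ 3 ≤ ∫ ω, ‖U ω‖ ^ 6 ∂μ := by
    have := pow_integral_le_integral_pow (hU.norm.pow 2) (fun ω => sq_nonneg ‖U ω‖)
      (R := R ^ 2) (hR.mono fun ω hω => pow_le_pow_left₀ (norm_nonneg _) hω 2) 3
    simpa only [Pi.pow_apply, ← pow_mul] using this
  have hnorm : ‖v - m - ‖m‖ ^ 2 • m‖ ≤ A * ‖m‖ + ‖m‖ + A * ‖m‖ := by
    refine (norm_sub_le _ _).trans (add_le_add ((norm_sub_le _ _).trans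
      (add_le_add_left hvA _)) ?_)
    rw [norm_smul, norm_pow, norm_norm]
    gcongr
  rw [hsum]
  refine (pow_le_pow_left₀ (norm_nonneg _) hnorm 2).trans ?_
  exact (sq_add_add_le_of_sq_le hA0 hmA).trans (by linarith)

/-- The unnormalized noise `x - λ_t θ`. -/
def noise {d : ℕ} (t : ℝ) (x θ : Vec d) : Vec d := x - rexp (-t) • θ

theorem continuous_noise {d : ℕ} (t : ℝ) (x : Vec d) : Continuous (noise t x) := by
  unfold noise
  fun_prop

theorem continuous_weight_right {d : ℕ} (t : ℝ) (x : Vec d) : Continuous (weight t x) := by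
  unfold weight
  fun_prop

theorem norm_noise_sq_mul_weight_le {d : ℕ} {t : ℝ} (ht : 0 < t) (x θ : Vec d) :
    ‖noise t x θ‖ ^ 2 * weight t x θ ≤ 2 * (1 - rexp (-2 * t)) := by
  have hs := one_sub_exp_neg_two_mul_pos ht
  set s := 1 - rexp (-2 * t)
  have hz : ‖noise t x θ‖ ^ 2 = 2 * s * (‖noise t x θ‖ ^ 2 / (2 * s)) := by
    field_simp
  have hw : weight t x θ = rexp (-(‖noise t x θ‖ ^ 2 / (2 * s))) := by
    rw [weight, noise, neg_div]
  rw [hw, hz]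
  set z := ‖noise t x θ‖ ^ 2 / (2 * s)
  have hexp : z * rexp (-z) ≤ 1 := by
    rw [Real.exp_neg, ← div_eq_mul_inv, div_le_one (Real.exp_pos z)]
    linarith [Real.add_one_le_exp z]
  have hzz : 2 * s * z / (2 * s) = z := by field_simp
  rw [hzz, mul_assoc]
  exact mul_le_of_le_one_right (by positivity) hexp

theorem abs_noise_mul_noise_mul_weight_le {d : ℕ} {t : ℝ} (ht : 0 < t) (x θ : Vec d)
    (i j : Fin d) :
    |noise t x θ i * noise t x θ j * weight t x θ| ≤ 2 * (1 - rexp (-2 * t)) := by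
  rw [abs_mul, abs_of_pos (weight_pos t x θ), abs_mul]
  refine le_trans (mul_le_mul_of_nonneg_right ?_ (weight_pos t x θ).le)
    (norm_noise_sq_mul_weight_le ht x θ)
  rw [sq]
  exact mul_le_mul (PiLp.norm_apply_le (noise t x θ) i)
    (PiLp.norm_apply_le (noise t x θ) j) (abs_nonneg _) (norm_nonneg _)

theorem abs_noise_mul_weight_le {d : ℕ} {t : ℝ} (ht : 0 < t) (x θ : Vec d) (j : Fin d) :
    |noise t x θ j * weight t x θ| ≤ 1 + 2 * (1 - rexp (-2 * t)) := by
  have h1 := weight_le_one ht x θ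
  have h2 := abs_noise_mul_noise_mul_weight_le ht x θ j j
  have hw := weight_pos t x θ
  rw [abs_mul, abs_of_pos hw] at h2 ⊢
  rw [abs_mul, ← sq] at h2
  nlinarith [sq_nonneg (|noise t x θ j| - 1)]

theorem hasDerivAt_noise_apply {d : ℕ} (t : ℝ) (x θ : Vec d) (i j : Fin d) (r : ℝ) :
    HasDerivAt (fun r : ℝ => noise t (x + r • EuclideanSpace.single i 1) θ j)
      (if i = j then 1 else 0) r := by
  have h : (fun r : ℝ => noise t (x + r • EuclideanSpace.single i 1) θ j) =
      fun r : ℝ => x j + r * (if i = j then 1 else 0) - rexp (-t) * θ j := by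
    funext r
    simp [noise, eq_comm]
  rw [h]
  simpa using (((hasDerivAt_id r).mul_const (if i = j then (1 : ℝ) else 0)).const_add
    (x j)).sub_const (rexp (-t) * θ j)

theorem hasDerivAt_weight {d : ℕ} {t : ℝ} (ht : 0 < t) (x θ : Vec d) (i : Fin d) (r : ℝ) :
    HasDerivAt (fun r : ℝ => weight t (x + r • EuclideanSpace.single i 1) θ)
      (-(noise t (x + r • EuclideanSpace.single i 1) θ i *
        weight t (x + r • EuclideanSpace.single i 1) θ) / (1 - rexp (-2 * t))) r := by
  have hs := one_sub_exp_neg_two_mul_pos ht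
  have h1 : HasDerivAt (fun r : ℝ => x + r • EuclideanSpace.single i 1 - rexp (-t) • θ)
      (EuclideanSpace.single i (1 : ℝ)) r := by
    simpa using (((hasDerivAt_id r).smul_const (EuclideanSpace.single i (1 : ℝ))).const_add
      x).sub_const (rexp (-t) • θ)
  have h2 := (h1.norm_sq.neg.div_const (2 * (1 - rexp (-2 * t)))).exp
  refine h2.congr_deriv ?_
  rw [EuclideanSpace.inner_single_right]
  simp only [weight, noise, conj_trivial, one_mul, Pi.neg_apply]
  field_simp

theorem hasDerivAt_integral_weight {d : ℕ} (q0 : Measure (Vec d)) [IsProbabilityMeasure q0]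
    {t : ℝ} (ht : 0 < t) (x : Vec d) (i : Fin d) :
    HasDerivAt (fun r : ℝ => ∫ θ, weight t (x + r • EuclideanSpace.single i 1) θ ∂q0)
      (-(∫ θ, noise t x θ i * weight t x θ ∂q0) / (1 - rexp (-2 * t))) 0 := by
  have hs := one_sub_exp_neg_two_mul_pos ht
  have h := (hasDerivAt_integral_of_dominated_loc_of_deriv_le (μ := q0) (x₀ := (0 : ℝ))
    (F := fun r θ => weight t (x + r • EuclideanSpace.single i 1) θ)
    (F' := fun r θ => -(noise t (x + r • EuclideanSpace.single i 1) θ i *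
        weight t (x + r • EuclideanSpace.single i 1) θ) / (1 - rexp (-2 * t)))
    (bound := fun _ => (1 + 2 * (1 - rexp (-2 * t))) / (1 - rexp (-2 * t)))
    Filter.univ_mem
    (Filter.Eventually.of_forall fun r => (continuous_weight_right t _).aestronglyMeasurable)
    (integrable_weight q0 ht _) ?_ (ae_of_all _ fun θ r _ => ?_) (integrable_const _)
    (ae_of_all _ fun θ r _ => hasDerivAt_weight ht x θ i r)).2
  · refine h.congr_deriv ?_
    simp only [zero_smul, add_zero, integral_div, integral_neg]
  · have h1 := continuous_noise t (x + (0 : ℝ) • EuclideanSpace.single i 1)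
    have h2 := continuous_weight_right t (x + (0 : ℝ) • EuclideanSpace.single i 1)
    exact Continuous.aestronglyMeasurable (by fun_prop)
  · rw [norm_div, norm_neg, Real.norm_of_nonneg hs.le]
    gcongr
    exact abs_noise_mul_weight_le ht _ θ i

theorem hasDerivAt_integral_noise_mul_weight {d : ℕ} (q0 : Measure (Vec d))
    [IsProbabilityMeasure q0] {t : ℝ} (ht : 0 < t) (x : Vec d) (i j : Fin d) :
    HasDerivAt (fun r : ℝ => ∫ θ, noise t (x + r • EuclideanSpace.single i 1) θ j *
        weight t (x + r • EuclideanSpace.single i 1) θ ∂q0)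
      ((if i = j then 1 else 0) * (∫ θ, weight t x θ ∂q0) -
        (∫ θ, noise t x θ i * noise t x θ j * weight t x θ ∂q0) / (1 - rexp (-2 * t))) 0 := by
  have hs := one_sub_exp_neg_two_mul_pos ht
  have hmeas2 (x : Vec d) : AEStronglyMeasurable
      (fun θ => noise t x θ i * noise t x θ j * weight t x θ) q0 := by
    have h1 := continuous_noise t x
    have h2 := continuous_weight_right t x
    exact Continuous.aestronglyMeasurable (by fun_prop)
  have hmeas1 (x : Vec d) : AEStronglyMeasurable
      (fun θ => noise t x θ j * weight t x θ) q0 := by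
    have h1 := continuous_noise t x
    have h2 := continuous_weight_right t x
    exact Continuous.aestronglyMeasurable (by fun_prop)
  have h := (hasDerivAt_integral_of_dominated_loc_of_deriv_le (μ := q0) (x₀ := (0 : ℝ))
    (F := fun r θ => noise t (x + r • EuclideanSpace.single i 1) θ j *
      weight t (x + r • EuclideanSpace.single i 1) θ)
    (F' := fun r θ => (if i = j then 1 else 0) * weight t (x + r • EuclideanSpace.single i 1) θ -
      noise t (x + r • EuclideanSpace.single i 1) θ i *
      noise t (x + r • EuclideanSpace.single i 1) θ j *
        weight t (x + r • EuclideanSpace.single i 1) θ / (1 - rexp (-2 * t)))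
    (bound := fun _ => 1 + 2 * (1 - rexp (-2 * t)) / (1 - rexp (-2 * t)))
    Filter.univ_mem
    (Filter.Eventually.of_forall fun r => hmeas1 _)
    (Integrable.of_bound (hmeas1 _) _ (ae_of_all _ fun θ => abs_noise_mul_weight_le ht _ θ j))
    ?_ (ae_of_all _ fun θ r _ => ?_) (integrable_const _)
    (ae_of_all _ fun θ r _ => ?_)).2
  · refine h.congr_deriv ?_
    simp only [zero_smul, add_zero]
    rw [integral_sub ((integrable_weight q0 ht x).const_mul _), integral_const_mul, integral_div]
    exact (Integrable.of_bound (hmeas2 x) _ (ae_of_all _ fun θ =>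
      abs_noise_mul_noise_mul_weight_le ht x θ i j)).div_const _
  · simp only [div_eq_mul_inv]
    exact ((continuous_weight_right t _).aestronglyMeasurable.const_mul _).sub
      ((hmeas2 _).mul_const _)
  · refine (norm_sub_le _ _).trans (add_le_add ?_ ?_)
    · rw [norm_mul, Real.norm_of_nonneg (weight_pos t _ θ).le]
      have := weight_le_one ht (x + r • EuclideanSpace.single i 1) θ
      split_ifs <;> simp [this]
    · rw [norm_div, Real.norm_of_nonneg hs.le]
      gcongr
      exact abs_noise_mul_noise_mul_weight_le ht _ θ i j
  · refine ((hasDerivAt_noise_apply t x θ i j r).mul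
      (hasDerivAt_weight ht x θ i r)).congr_deriv ?_
    ring

theorem pd_eq_of_hasDerivAt {d : ℕ} {i : Fin d} {f : Vec d → ℝ} {x : Vec d} {v : ℝ}
    (hf : DifferentiableAt ℝ f x)
    (h : HasDerivAt (fun r : ℝ => f (x + r • EuclideanSpace.single i 1)) v 0) :
    pd i f x = v := by
  rw [pd, ← hf.lineDeriv_eq_fderiv, lineDeriv, h.deriv]

/-- The posterior law of `θ` given `λ_t θ + σ_t g = x`. -/
def noisePosterior {d : ℕ} (q0 : Measure (Vec d)) (t : ℝ) (x : Vec d) : Measure (Vec d) :=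
  q0.tilted fun θ => -‖x - rexp (-t) • θ‖ ^ 2 / (2 * (1 - rexp (-2 * t)))

theorem isProbabilityMeasure_noisePosterior {d : ℕ} (q0 : Measure (Vec d)) [IsProbabilityMeasure q0]
    {t : ℝ} (ht : 0 < t) (x : Vec d) : IsProbabilityMeasure (noisePosterior q0 t x) :=
  isProbabilityMeasure_tilted (integrable_weight q0 ht x)

theorem integral_noisePosterior {d : ℕ} (q0 : Measure (Vec d)) (t : ℝ) (x : Vec d) (f : Vec d → ℝ) :
    ∫ θ, f θ ∂(noisePosterior q0 t x) = (∫ θ, f θ * weight t x θ ∂q0) / ∫ θ, weight t x θ ∂q0 := by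
  rw [noisePosterior, integral_tilted, ← integral_div]
  refine integral_congr_ae (ae_of_all _ fun θ => ?_)
  simp only [weight, smul_eq_mul]
  ring

theorem integral_weight_pos {d : ℕ} (q0 : Measure (Vec d)) [IsProbabilityMeasure q0]
    {t : ℝ} (ht : 0 < t) (x : Vec d) : 0 < ∫ θ, weight t x θ ∂q0 :=
  integral_exp_pos (integrable_weight q0 ht x)

/-- The standardized noise `(x - λ_t θ) / σ_t`. -/
def stdNoise {d : ℕ} (t : ℝ) (x θ : Vec d) : Vec d := (√(1 - rexp (-2 * t)))⁻¹ • noise t x θ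

theorem continuous_stdNoise {d : ℕ} (t : ℝ) (x : Vec d) : Continuous (stdNoise t x) := by
  have := continuous_noise t x
  unfold stdNoise
  fun_prop

theorem pd_log_mul_integral_weight {d : ℕ} (q0 : Measure (Vec d)) [IsProbabilityMeasure q0]
    {t : ℝ} (ht : 0 < t) {c : ℝ} (hc : 0 < c)
    (hsmooth : ContDiff ℝ (⊤ : ℕ∞) fun y => Real.log (c * ∫ θ, weight t y θ ∂q0))
    (x : Vec d) (j : Fin d) :
    pd j (fun y => Real.log (c * ∫ θ, weight t y θ ∂q0)) x =
      -(∫ θ, noise t x θ j * weight t x θ ∂q0) /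
        ((1 - rexp (-2 * t)) * ∫ θ, weight t x θ ∂q0) := by
  have hs := one_sub_exp_neg_two_mul_pos ht
  have hZ := integral_weight_pos q0 ht x
  refine pd_eq_of_hasDerivAt (hsmooth.differentiable (by simp) x) ?_
  have h := ((hasDerivAt_integral_weight q0 ht x j).const_mul c).log
    (by simpa using ⟨hc.ne', hZ.ne'⟩)
  refine h.congr_deriv ?_
  simp only [zero_smul, add_zero]
  generalize 1 - rexp (-2 * t) = s at hs
  field_simp

theorem contDiff_pd {d : ℕ} {f : Vec d → ℝ} (hf : ContDiff ℝ (⊤ : ℕ∞) f) (i : Fin d) :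
    ContDiff ℝ (⊤ : ℕ∞) (pd i f) :=
  (hf.fderiv_right (m := (⊤ : ℕ∞)) (by simp)).clm_apply contDiff_const

theorem pd_pd_log_mul_integral_weight {d : ℕ} (q0 : Measure (Vec d)) [IsProbabilityMeasure q0]
    {t : ℝ} (ht : 0 < t) {c : ℝ} (hc : 0 < c)
    (hsmooth : ContDiff ℝ (⊤ : ℕ∞) fun y => Real.log (c * ∫ θ, weight t y θ ∂q0))
    (x : Vec d) (i j : Fin d) :
    pd i (pd j fun y => Real.log (c * ∫ θ, weight t y θ ∂q0)) x =
      ((∫ θ, noise t x θ i * noise t x θ j * weight t x θ ∂q0) / (∫ θ, weight t x θ ∂q0)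
          / (1 - rexp (-2 * t)) - (if i = j then 1 else 0)
        - (∫ θ, noise t x θ i * weight t x θ ∂q0) / (∫ θ, weight t x θ ∂q0) *
          ((∫ θ, noise t x θ j * weight t x θ ∂q0) / ∫ θ, weight t x θ ∂q0)
          / (1 - rexp (-2 * t))) / (1 - rexp (-2 * t)) := by
  have hs := one_sub_exp_neg_two_mul_pos ht
  have hZ := integral_weight_pos q0 ht x
  refine pd_eq_of_hasDerivAt ((contDiff_pd hsmooth j).differentiable (by simp) x) ?_
  simp_rw [pd_log_mul_integral_weight q0 ht hc hsmooth]
  have h := (hasDerivAt_integral_noise_mul_weight q0 ht x i j).neg.div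
    ((hasDerivAt_integral_weight q0 ht x i).const_mul (1 - rexp (-2 * t)))
    (by simpa only [zero_smul, add_zero] using mul_ne_zero hs.ne' hZ.ne')
  refine h.congr_deriv ?_
  simp only [zero_smul, add_zero, Pi.neg_apply]
  generalize 1 - rexp (-2 * t) = s at hs
  field_simp
  ring

theorem sum_sq_hessian_score_eq {d : ℕ} (q0 : Measure (Vec d)) [IsProbabilityMeasure q0]
    {t : ℝ} (ht : 0 < t) {c : ℝ} (hc : 0 < c)
    (hsmooth : ContDiff ℝ (⊤ : ℕ∞) fun y => Real.log (c * ∫ θ, weight t y θ ∂q0)) (x : Vec d) :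
    ∑ i, (∑ j, pd i (pd j fun y => Real.log (c * ∫ θ, weight t y θ ∂q0)) x
        * pd j (fun y => Real.log (c * ∫ θ, weight t y θ ∂q0)) x) ^ 2 =
      (∑ i, (∑ j, ((∫ θ, stdNoise t x θ i * stdNoise t x θ j ∂(noisePosterior q0 t x))
          - (if i = j then 1 else 0)
          - (∫ θ, stdNoise t x θ i ∂(noisePosterior q0 t x)) *
            ∫ θ, stdNoise t x θ j ∂(noisePosterior q0 t x)) *
          ∫ θ, stdNoise t x θ j ∂(noisePosterior q0 t x)) ^ 2) / (1 - rexp (-2 * t)) ^ 3 := by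
  have hs := one_sub_exp_neg_two_mul_pos ht
  have hZ := integral_weight_pos q0 ht x
  have hsq := Real.sq_sqrt hs.le
  have hσ := Real.sqrt_pos.2 hs
  have h1 (j : Fin d) : ∫ θ, stdNoise t x θ j ∂(noisePosterior q0 t x) =
      (√(1 - rexp (-2 * t)))⁻¹ * ((∫ θ, noise t x θ j * weight t x θ ∂q0) /
        ∫ θ, weight t x θ ∂q0) := by
    simp only [stdNoise, PiLp.smul_apply, smul_eq_mul, integral_const_mul, integral_noisePosterior]
  have h2 (i j : Fin d) : ∫ θ, stdNoise t x θ i * stdNoise t x θ j ∂(noisePosterior q0 t x) =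
      (1 - rexp (-2 * t))⁻¹ * ((∫ θ, noise t x θ i * noise t x θ j * weight t x θ ∂q0) /
        ∫ θ, weight t x θ ∂q0) := by
    rw [← integral_noisePosterior q0 t x fun θ => noise t x θ i * noise t x θ j, ← integral_const_mul]
    refine integral_congr_ae (ae_of_all _ fun θ => ?_)
    simp only [stdNoise, PiLp.smul_apply, smul_eq_mul]
    rw [← hsq, Real.sqrt_sq hσ.le]
    ring
  rw [Finset.sum_div]
  refine Finset.sum_congr rfl fun i _ => ?_
  have h3 : (1 - rexp (-2 * t)) ^ 3 = (-(1 - rexp (-2 * t)) * √(1 - rexp (-2 * t))) ^ 2 := by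
    rw [mul_pow, hsq]; ring
  rw [h3, ← div_pow, Finset.sum_div]
  congr 1
  refine Finset.sum_congr rfl fun j _ => ?_
  rw [pd_pd_log_mul_integral_weight q0 ht hc hsmooth, pd_log_mul_integral_weight q0 ht hc hsmooth,
    h1, h1, h2]
  generalize (∫ θ, noise t x θ i * noise t x θ j * weight t x θ ∂q0) = M
  generalize (∫ θ, noise t x θ i * weight t x θ ∂q0) = a
  generalize (∫ θ, noise t x θ j * weight t x θ ∂q0) = b
  generalize (∫ θ, weight t x θ ∂q0) = Z at hZ
  generalize √(1 - rexp (-2 * t)) = σ at hσ hsq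
  rw [← hsq]
  field_simp

theorem lintegral_norm_pow_six_stdGaussian_le (d : ℕ) :
    ∫⁻ g, ENNReal.ofReal (‖g‖ ^ 6) ∂(_root_.stdGaussian d) ≤
      ENNReal.ofReal ((d : ℝ) ^ 3 * ∫ y, y ^ 6 ∂(gaussianReal 0 1)) := by
  have hint : Integrable (fun y : ℝ => y ^ 6) (gaussianReal 0 1) := by
    have h := (memLp_id_gaussianReal' (μ := 0) (v := 1) 6 (by norm_num)).integrable_norm_pow
      (p := 6) (by norm_num)
    refine h.congr (ae_of_all _ fun y => ?_)
    simp only [id, Real.norm_eq_abs]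
    exact Even.pow_abs (by decide) y
  have hle (x : Fin d → ℝ) : ‖(EuclideanSpace.equiv (Fin d) ℝ).symm x‖ ^ 6 ≤
      (d : ℝ) ^ 2 * ∑ i, x i ^ 6 := by
    have h := pow_sum_le_card_mul_sum_pow (s := Finset.univ) (f := fun i => x i ^ 2)
      (fun i _ => sq_nonneg (x i)) 2
    rw [show 6 = 2 * 3 from rfl, pow_mul, EuclideanSpace.norm_sq_eq]
    simpa [← pow_mul] using h
  rw [_root_.stdGaussian, lintegral_map (by fun_prop) (by fun_prop)]
  calc ∫⁻ x, ENNReal.ofReal (‖(EuclideanSpace.equiv (Fin d) ℝ).symm x‖ ^ 6)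
        ∂(Measure.pi fun _ : Fin d => gaussianReal 0 1)
      ≤ ∫⁻ x, ENNReal.ofReal ((d : ℝ) ^ 2) * ∑ i, ENNReal.ofReal (x i ^ 6)
        ∂(Measure.pi fun _ : Fin d => gaussianReal 0 1) := by
        refine lintegral_mono fun x => ?_
        rw [← ENNReal.ofReal_sum_of_nonneg fun i _ => Even.pow_nonneg (by decide) _,
          ← ENNReal.ofReal_mul (by positivity)]
        exact ENNReal.ofReal_le_ofReal (hle x)
    _ = ENNReal.ofReal ((d : ℝ) ^ 2) * ∑ _i : Fin d,
          ENNReal.ofReal (∫ y, y ^ 6 ∂(gaussianReal 0 1)) := by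
        rw [lintegral_const_mul _ (by fun_prop), lintegral_finsetSum _ (by fun_prop)]
        congr 1
        refine Finset.sum_congr rfl fun i _ => ?_
        rw [ofReal_integral_eq_lintegral_ofReal hint
          (ae_of_all _ fun y => Even.pow_nonneg (by decide) y)]
        exact (measurePreserving_eval (fun _ : Fin d => gaussianReal 0 1) i).lintegral_comp
          (f := fun y => ENNReal.ofReal (y ^ 6)) (by fun_prop)
    _ = ENNReal.ofReal ((d : ℝ) ^ 3 * ∫ y, y ^ 6 ∂(gaussianReal 0 1)) := by
        rw [Finset.sum_const, Finset.card_univ, Fintype.card_fin, nsmul_eq_mul, ← mul_assoc,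
          ← ENNReal.ofReal_natCast, ← ENNReal.ofReal_mul (by positivity),
          ← ENNReal.ofReal_mul (by positivity)]
        congr 2

theorem norm_stdNoise_le {d : ℕ} {t R : ℝ} {x θ : Vec d} (hθ : ‖θ‖ ≤ R) :
    ‖stdNoise t x θ‖ ≤ (√(1 - rexp (-2 * t)))⁻¹ * (‖x‖ + rexp (-t) * R) := by
  rw [stdNoise, norm_smul, Real.norm_of_nonneg (by positivity)]
  refine mul_le_mul_of_nonneg_left ((norm_sub_le _ _).trans ?_) (by positivity)
  rw [norm_smul, Real.norm_of_nonneg (Real.exp_pos _).le]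
  gcongr

theorem lintegral_integral_noisePosterior_norm_pow_six_le {d : ℕ} (q0 : Measure (Vec d))
    [IsProbabilityMeasure q0] {R : ℝ} (hR : ∀ᵐ θ ∂q0, ‖θ‖ ≤ R) {t : ℝ} (ht : 0 < t) :
    ∫⁻ x, ENNReal.ofReal (∫ θ, ‖stdNoise t x θ‖ ^ 6 ∂(noisePosterior q0 t x)) ∂(forwardLaw q0 t) ≤
      ENNReal.ofReal ((d : ℝ) ^ 3 * ∫ y, y ^ 6 ∂(gaussianReal 0 1)) := by
  have hc := gaussianConst_pos d ht
  have hs := one_sub_exp_neg_two_mul_pos ht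
  have hU : Continuous fun p : Vec d × Vec d => ‖stdNoise t p.2 p.1‖ ^ 6 := by
    unfold stdNoise noise
    fun_prop
  have hW : Continuous fun p : Vec d × Vec d => weight t p.2 p.1 := by
    unfold weight
    fun_prop
  have hdens (x : Vec d) : ENNReal.ofReal (gaussianConst d t * ∫ θ, weight t x θ ∂q0) *
        ENNReal.ofReal (∫ θ, ‖stdNoise t x θ‖ ^ 6 ∂(noisePosterior q0 t x)) =
      ∫⁻ θ, ENNReal.ofReal (gaussianConst d t * weight t x θ) *
        ENNReal.ofReal (‖stdNoise t x θ‖ ^ 6) ∂q0 := by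
    have hZ := integral_weight_pos q0 ht x
    have hint : Integrable (fun θ => ‖stdNoise t x θ‖ ^ 6 * weight t x θ) q0 := by
      have h1 := continuous_stdNoise t x
      have h2 := continuous_weight_right t x
      refine Integrable.of_bound
        (C := ((√(1 - rexp (-2 * t)))⁻¹ * (‖x‖ + rexp (-t) * R)) ^ 6 * 1)
        (Continuous.aestronglyMeasurable (by fun_prop)) (hR.mono fun θ hθ => ?_)
      rw [norm_mul, norm_pow, norm_norm, Real.norm_of_nonneg (weight_pos t x θ).le]
      have h3 := norm_stdNoise_le (t := t) (x := x) hθ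
      have h4 := pow_le_pow_left₀ (norm_nonneg _) h3 6
      exact mul_le_mul h4 (weight_le_one ht x θ) (weight_pos t x θ).le
        ((pow_nonneg (norm_nonneg _) 6).trans h4)
    rw [← ENNReal.ofReal_mul (by positivity), integral_noisePosterior, mul_assoc,
      mul_div_cancel₀ _ hZ.ne', ← integral_const_mul,
      ofReal_integral_eq_lintegral_ofReal (hint.const_mul _)
        (ae_of_all _ fun θ => by have := weight_pos t x θ; positivity)]
    refine lintegral_congr fun θ => ?_
    rw [← ENNReal.ofReal_mul (mul_pos hc (weight_pos t x θ)).le]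
    congr 1
    ring
  calc _ ≤ ∫⁻ x, ENNReal.ofReal (gaussianConst d t * ∫ θ, weight t x θ ∂q0) *
        ENNReal.ofReal (∫ θ, ‖stdNoise t x θ‖ ^ 6 ∂(noisePosterior q0 t x)) := by
        rw [forwardLaw_eq_withDensity q0 ht]
        exact lintegral_withDensity_le_lintegral_mul _
          ((continuous_integral_weight q0 ht).const_mul _).measurable.ennreal_ofReal _
    _ = ∫⁻ θ, (∫⁻ x, ENNReal.ofReal (gaussianConst d t * weight t x θ) *
        ENNReal.ofReal (‖stdNoise t x θ‖ ^ 6)) ∂q0 := by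
        simp_rw [hdens]
        refine (lintegral_lintegral_swap (Measurable.aemeasurable ?_)).symm
        exact (hW.measurable.const_mul _).ennreal_ofReal.mul hU.measurable.ennreal_ofReal
    _ = ∫⁻ _θ, ∫⁻ g, ENNReal.ofReal (‖g‖ ^ 6) ∂(_root_.stdGaussian d) ∂q0 := by
        refine lintegral_congr fun θ => ?_
        have hf : Measurable fun x => ENNReal.ofReal (‖stdNoise t x θ‖ ^ 6) :=
          (hU.comp (Continuous.prodMk_right θ)).measurable.ennreal_ofReal
        rw [← lintegral_stdGaussian_affine ht θ hf]
        refine lintegral_congr fun g => ?_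
        rw [stdNoise, noise, add_sub_cancel_left, smul_smul,
          inv_mul_cancel₀ (Real.sqrt_pos.2 hs).ne', one_smul]
    _ ≤ _ := by
        rw [lintegral_const, measure_univ, mul_one]
        exact lintegral_norm_pow_six_stdGaussian_le d

theorem aestronglyMeasurable_integral_noisePosterior_norm_pow_six {d : ℕ} (q0 : Measure (Vec d))
    [IsProbabilityMeasure q0] (t : ℝ) (ν : Measure (Vec d)) :
    AEStronglyMeasurable
      (fun x => ∫ θ, ‖stdNoise t x θ‖ ^ 6 ∂(noisePosterior q0 t x)) ν := by
  have hW : Continuous fun p : Vec d × Vec d => weight t p.1 p.2 := continuous_weight t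
  have hUW : Continuous fun p : Vec d × Vec d => ‖stdNoise t p.1 p.2‖ ^ 6 * weight t p.1 p.2 := by
    unfold stdNoise noise
    fun_prop
  simp_rw [integral_noisePosterior]
  have h1 : StronglyMeasurable fun x => ∫ θ, ‖stdNoise t x θ‖ ^ 6 * weight t x θ ∂q0 :=
    hUW.stronglyMeasurable.integral_prod_right
  have h2 : StronglyMeasurable fun x => ∫ θ, weight t x θ ∂q0 :=
    hW.stronglyMeasurable.integral_prod_right
  exact (h1.measurable.div h2.measurable).aestronglyMeasurable

/-- **Lemma (second moment of Hessian applied to the score).** Under the bounded-support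
assumption, `E_{X ~ q_t}[‖∇_x² log q_t(X) · ∇_x log q_t(X)‖²] ≤ C d³ σ_t⁻⁶` for a universal
constant `C`. -/
theorem hessian_score_second_moment :
    ∃ C > (0:ℝ),
    ∀ (d : ℕ), 1 ≤ d →
    ∀ (q0 : Measure (Vec d)), IsProbabilityMeasure q0 →
    (∀ᵐ y ∂q0, ‖y‖ ≤ Real.sqrt d) →
    ∀ (ρ : ℝ → Vec d → ℝ),
    (∀ u, 0 < u → forwardLaw q0 u = volume.withDensity fun x => ENNReal.ofReal (ρ u x)) →
    (∀ u, 0 < u → ∀ x, 0 < ρ u x) →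
    (∀ u, 0 < u → ContDiff ℝ (⊤ : ℕ∞) (ρ u)) →
    ∀ (t : ℝ), 0 < t →
    ∫ x, ∑ i, (∑ j, pd i (pd j (fun y => Real.log (ρ t y))) x
                  * pd j (fun y => Real.log (ρ t y)) x)^2
        ∂(forwardLaw q0 t)
      ≤ C * (d:ℝ)^3 / (1 - Real.exp (-2*t))^3 := by
  have hC0 : 0 ≤ ∫ y, y ^ 6 ∂(gaussianReal 0 1) :=
    integral_nonneg fun y => Even.pow_nonneg (by decide) y
  refine ⟨3 + 9 * ∫ y, y ^ 6 ∂(gaussianReal 0 1), by positivity, ?_⟩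
  intro d hd q0 hq0 hsupp ρ hρ hpos hsmooth t ht
  have hs := one_sub_exp_neg_two_mul_pos ht
  have hc := gaussianConst_pos d ht
  have hρeq : ρ t = fun y => gaussianConst d t * ∫ θ, weight t y θ ∂q0 :=
    funext (eq_integral_weight_of_forwardLaw_eq q0 ht (hρ t ht) (hpos t ht)
      (hsmooth t ht).continuous)
  have hlog : ContDiff ℝ (⊤ : ℕ∞)
      fun y => Real.log (gaussianConst d t * ∫ θ, weight t y θ ∂q0) := by
    have h := (hsmooth t ht).log fun x => (hpos t ht x).ne'
    simpa only [hρeq] using h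
  have hprob : IsProbabilityMeasure (forwardLaw q0 t) :=
    Measure.isProbabilityMeasure_map (by fun_prop)
  set B : Vec d → ℝ := fun x => ∫ θ, ‖stdNoise t x θ‖ ^ 6 ∂(noisePosterior q0 t x)
  have hB0 (x : Vec d) : 0 ≤ B x := integral_nonneg fun θ => by positivity
  have hBmeas : AEStronglyMeasurable B (forwardLaw q0 t) :=
    aestronglyMeasurable_integral_noisePosterior_norm_pow_six q0 t _
  have hBle := lintegral_integral_noisePosterior_norm_pow_six_le q0 hsupp ht
  have hBint : Integrable B (forwardLaw q0 t) := by
    refine ⟨hBmeas, ?_⟩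
    rw [hasFiniteIntegral_iff_ofReal (ae_of_all _ hB0)]
    exact hBle.trans_lt ENNReal.ofReal_lt_top
  have hBbound : ∫ x, B x ∂(forwardLaw q0 t) ≤ (d : ℝ) ^ 3 * ∫ y, y ^ 6 ∂(gaussianReal 0 1) := by
    rw [integral_eq_lintegral_of_nonneg_ae (ae_of_all _ hB0) hBmeas]
    exact ENNReal.toReal_le_of_le_ofReal (by positivity) hBle
  have hpt (x : Vec d) : ∑ i, (∑ j, pd i (pd j (fun y => Real.log (ρ t y))) x
      * pd j (fun y => Real.log (ρ t y)) x)^2 ≤ (3 + 9 * B x) / (1 - rexp (-2 * t)) ^ 3 := by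
    have := isProbabilityMeasure_noisePosterior q0 ht x
    rw [hρeq, sum_sq_hessian_score_eq q0 ht hc hlog x]
    refine div_le_div_of_nonneg_right ?_ (by positivity)
    refine sum_sq_centered_second_moment_le (continuous_stdNoise t x).aestronglyMeasurable
      (R := (√(1 - rexp (-2 * t)))⁻¹ * (‖x‖ + rexp (-t) * √d)) ?_
    exact (tilted_absolutelyContinuous q0 _).ae_le (hsupp.mono fun θ hθ => norm_stdNoise_le hθ)
  refine (integral_mono_of_nonneg (ae_of_all _ fun x => Finset.sum_nonneg fun i _ => sq_nonneg _)
    (((integrable_const 3).add (hBint.const_mul 9)).div_const _) (ae_of_all _ hpt)).trans ?_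
  rw [integral_div]
  refine div_le_div_of_nonneg_right ?_ (by positivity)
  rw [integral_add' (integrable_const _) (hBint.const_mul 9), integral_const_mul]
  have hd3 : (1 : ℝ) ≤ (d : ℝ) ^ 3 := one_le_pow₀ (by exact_mod_cast hd)
  simp only [integral_const, probReal_univ, one_smul]
  linarith

end
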